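/- arXiv:2402.14661 — 2 statements merged into one kernel-verified Lean document; each statement's English description precedes it below -/
import Mathlib

section
/- Let (X, ∗) be a finite quandle of odd cardinality with |X| ≥ 3. Then the quandle ring ℤ₂[X] contains a non-trivial idempotent, namely the all-ones element u₀ = ∑_{x∈X} e_x satisfies u₀·u₀ = u₀, u₀ ≠ 0, and u₀ ≠ e_x for every x ∈ X. -/
/-- The quandle ring multiplication on `ℤ₂[X]`, modeled as functions `X → ZMod 2`. -/
def qmul {X : Type*} [Fintype X] [DecidableEq X] (op : X → X → X)
    (u v : X → ZMod 2) : X → ZMod 2 :=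
  fun z => ∑ x : X, ∑ y : X, if op x y = z then u x * v y else 0

/-- The basis element `e_x` of the quandle ring, the indicator function of `{x}`. -/
def eb {X : Type*} [DecidableEq X] (x : X) : X → ZMod 2 :=
  fun z => if z = x then 1 else 0

/-- A finite quandle `(X, ∗)` of odd cardinality `≥ 3` has a non-trivial idempotent
in `ℤ₂[X]`, namely the all-ones element `u₀ = ∑_{x∈X} e_x`: it satisfies
`u₀ · u₀ = u₀`, `u₀ ≠ 0`, and `u₀ ≠ e_x` for every `x`. -/
theorem allOnes_nontrivial_idempotent {X : Type*} [Fintype X] [DecidableEq X]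
    (op : X → X → X)
    (hidem : ∀ x, op x x = x)
    (hbij : ∀ y, Function.Bijective fun x => op x y)
    (hdist : ∀ x y z, op (op x y) z = op (op x z) (op y z))
    (hodd : Odd (Fintype.card X)) (hcard : 3 ≤ Fintype.card X) :
    qmul op (fun _ => 1) (fun _ => 1) = (fun _ => 1) ∧
      (fun _ : X => (1 : ZMod 2)) ≠ 0 ∧
      ∀ x : X, (fun _ : X => (1 : ZMod 2)) ≠ eb x := by
  refine ⟨?_, ?_, ?_⟩
  · funext z
    have h (y : X) : (∑ x : X, if op x y = z then (1 : ZMod 2) * 1 else 0) = 1 := by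
      obtain ⟨a, ha, huniq⟩ := (hbij y).existsUnique z
      rw [Finset.sum_eq_single a (fun b _ hb => if_neg fun h => hb (huniq b h)) (by simp),
        if_pos ha, one_mul]
    unfold qmul
    rw [Finset.sum_comm, Finset.sum_congr rfl fun y _ => h y]
    simpa using (ZMod.natCast_eq_one_iff_odd).2 hodd
  · intro h
    obtain ⟨x⟩ : Nonempty X := Fintype.card_pos_iff.1 (by lia)
    exact one_ne_zero (congrFun h x)
  · intro x h
    obtain ⟨y, hy⟩ := Fintype.exists_ne_of_one_lt_card (by lia) x
    exact one_ne_zero ((congrFun h y).trans (if_neg hy))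
end

section
/- Let (X, ∗) be a finite quandle having a subquandle Y ⊆ X with |Y| ≥ 2, and let k be a field in which the image of the natural number |Y| is nonzero. Then the element u : X → k defined by u(x) = (|Y| : k)⁻¹ if x ∈ Y and u(x) = 0 otherwise is an idempotent of the quandle ring k[X] (i.e. for every z ∈ X, ∑_{(x,x')∈X×X, x∗x'=z} u(x)·u(x') = u(z)), and u is non-trivial: u ≠ e_x for every x ∈ X. In particular k[X] has a non-trivial idempotent. -/
/-- A right translation of a finite set by an element of a closed subset `S` preserves
membership in `S`, provided that it is injective. -/
theorem op_mem_iff_of_closed {X : Type*} [DecidableEq X] {op : X → X → X} {S : Finset X}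
    (hclosed : ∀ x ∈ S, ∀ y ∈ S, op x y ∈ S) {y : X} (hy : y ∈ S)
    (hinj : Function.Injective fun x => op x y) (x : X) : op x y ∈ S ↔ x ∈ S := by
  refine ⟨fun h => ?_, fun h => hclosed x h y hy⟩
  have himage : S.image (fun x => op x y) = S :=
    Finset.eq_of_subset_of_card_le
      (Finset.image_subset_iff.2 fun a ha => hclosed a ha y hy)
      (Finset.card_image_of_injective S hinj).ge
  rw [← himage] at h
  exact (hinj.mem_finset_image (f := fun x => op x y)).1 h


/-- If a finite quandle `(X, ∗)` has a subquandle `S` with `|S| ≥ 2`, and `k` is a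
field in which `(|S| : k) ≠ 0`, then `u : X → k` equal to `(|S| : k)⁻¹` on `S` and
`0` elsewhere is a non-trivial idempotent of `k[X]`: `u · u = u`, `u ≠ 0`, and
`u ≠ e_x` for every `x ∈ X`.  In particular `k[X]` has a non-trivial idempotent. -/
theorem subquandle_gives_nontrivial_idempotent {X : Type*} [Fintype X] [DecidableEq X]
    (op : X → X → X)
    (hidem : ∀ x, op x x = x)
    (hbij : ∀ y, Function.Bijective fun x => op x y)
    (hdist : ∀ x y z, op (op x y) z = op (op x z) (op y z))
    {k : Type*} [Field k]
    (S : Finset X)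
    (hclosed : ∀ x ∈ S, ∀ y ∈ S, op x y ∈ S)
    (hcard : 2 ≤ S.card)
    (hchar : (S.card : k) ≠ 0)
    (u : X → k)
    (hu : u = fun x => if x ∈ S then (S.card : k)⁻¹ else 0) :
    (∀ z : X, (∑ x : X, ∑ x' : X, if op x x' = z then u x * u x' else 0) = u z) ∧
      u ≠ 0 ∧
      ∀ x : X, u ≠ fun z => if z = x then (1 : k) else 0 := by
  subst hu
  refine ⟨fun z => ?_, fun h => ?_, fun x h => ?_⟩
  · set u : X → k := fun x => if x ∈ S then (S.card : k)⁻¹ else 0 with hu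
    have hsum : ∑ y, u y = 1 := by simp [hu, hchar]
    have hinner (y : X) : (∑ x, if op x y = z then u x * u y else 0) = u z * u y := by
      by_cases hy : y ∈ S
      · have huop (x : X) : u (op x y) = u x := by
          simp only [hu, op_mem_iff_of_closed hclosed hy (hbij y).injective]
        calc (∑ x, if op x y = z then u x * u y else 0)
            = ∑ x, if op x y = z then u (op x y) * u y else 0 := by simp only [huop]
          _ = ∑ w, if w = z then u w * u y else 0 :=
              (hbij y).sum_comp fun w => if w = z then u w * u y else 0
          _ = u z * u y := by simp
      · simp [show u y = 0 from if_neg hy]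
    rw [Finset.sum_comm, Finset.sum_congr rfl fun y _ => hinner y, ← Finset.mul_sum, hsum,
      mul_one]
  · obtain ⟨y, hy⟩ : S.Nonempty := Finset.card_pos.1 (by omega)
    have := congrFun h y
    simp [hy, hchar] at this
  · obtain ⟨y, hy, hyx⟩ := Finset.exists_mem_ne (by omega : 1 < S.card) x
    have := congrFun h y
    simp [hy, hyx, hchar] at this
end
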